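/- Let H be a Hilbert space decomposed as an orthogonal direct sum H = ⊕_{k≥0} H_k with each H_k finite-dimensional and nonzero, and let Q_k be the projection onto H_k. Let V be a bounded operator on H commuting with each Q_k (block diagonal). If V* V − I is compact, then the image of V in the Calkin algebra B(H)/K(H) is invertible. Consequently, the C*-algebra of images in the Calkin algebra of block-diagonal operators (with respect to {Q_k}) is a finite C*-algebra: every isometry in it is a unitary. -/

import Mathlib

/-- Finitely many members of a jointly injective sequence of linear maps are already jointly
injective on a given finite-dimensional subspace. -/
lemma exists_forall_lt_imp_eq_zero {𝕜 E F : Type*} [Field 𝕜] [AddCommGroup E] [Module 𝕜 E]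
    [AddCommGroup F] [Module 𝕜 F] (f : ℕ → E →ₗ[𝕜] F) (hf : ∀ x, (∀ k, f k x = 0) → x = 0)
    (S : Submodule 𝕜 E) [FiniteDimensional 𝕜 S] :
    ∃ N, ∀ x ∈ S, (∀ k < N, f k x = 0) → x = 0 := by
  let c : ℕ →o (Submodule 𝕜 S)ᵒᵈ :=
    { toFun := fun n => OrderDual.toDual (⨅ k, ⨅ _ : k < n, LinearMap.ker (f k ∘ₗ S.subtype))
      monotone' := fun m n hmn => by
        refine OrderDual.toDual_le_toDual.2 fun x hx => ?_
        simp only [Submodule.mem_iInf] at hx ⊢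
        exact fun k hk => hx k (hk.trans_le hmn) }
  have mem_c (n : ℕ) (x : S) : x ∈ OrderDual.ofDual (c n) ↔ ∀ k < n, f k x = 0 := by
    simp [c, Submodule.mem_iInf]
  obtain ⟨N, hN⟩ := IsArtinian.monotone_stabilizes c
  refine ⟨N, fun x hxS hx => hf x fun k => ?_⟩
  have hxN : (⟨x, hxS⟩ : S) ∈ OrderDual.ofDual (c N) := (mem_c N _).2 hx
  rw [hN (max N (k + 1)) (le_max_left _ _)] at hxN
  exact (mem_c _ _).1 hxN k (by omega)

namespace IsCompactOperator

variable {𝕜 E : Type*} [NontriviallyNormedField 𝕜] [NormedAddCommGroup E] [NormedSpace 𝕜 E]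

lemma mul_left {f : E →L[𝕜] E} (hf : IsCompactOperator ⇑f) (g : E →L[𝕜] E) :
    IsCompactOperator ⇑(g * f) :=
  hf.clm_comp g

lemma mul_right {f : E →L[𝕜] E} (hf : IsCompactOperator ⇑f) (g : E →L[𝕜] E) :
    IsCompactOperator ⇑(f * g) :=
  hf.comp_clm g

end IsCompactOperator

lemma isCompactOperator_of_finiteDimensional_range {𝕜 E F : Type*} [NontriviallyNormedField 𝕜]
    [LocallyCompactSpace 𝕜] [CompleteSpace 𝕜] [NormedAddCommGroup E] [NormedSpace 𝕜 E]
    [NormedAddCommGroup F] [NormedSpace 𝕜 F] (f : E →L[𝕜] F)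
    [FiniteDimensional 𝕜 (LinearMap.range (f : E →ₗ[𝕜] F))] : IsCompactOperator ⇑f := by
  let R := LinearMap.range (f : E →ₗ[𝕜] F)
  have : ProperSpace R := FiniteDimensional.proper 𝕜 R
  have h : IsCompactOperator (_root_.id : R → R) := isCompactOperator_id
  exact (h.comp_clm (f.codRestrict R fun x => ⟨x, rfl⟩)).clm_comp R.subtypeL

section Hilbert

variable {H : Type*} [NormedAddCommGroup H] [InnerProductSpace ℂ H] [CompleteSpace H]

open ContinuousLinearMap

/-- By the Fredholm alternative, an injective operator with injective adjoint which is an isometry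
modulo the compact operators is a unitary modulo the compact operators. -/
lemma isCompactOperator_mul_adjoint_sub_one_of_injective {T : H →L[ℂ] H}
    (hT : IsCompactOperator ⇑(adjoint T * T - 1)) (hinj : ∀ x, T x = 0 → x = 0)
    (hinj_adj : ∀ x, adjoint T x = 0 → x = 0) :
    IsCompactOperator ⇑(T * adjoint T - 1) := by
  have hunit : IsUnit (adjoint T * T) := by
    rcases hT.hasEigenvalue_or_mem_resolventSet (μ := -1) (by norm_num) with h | h
    · obtain ⟨x, hx⟩ := h.exists_hasEigenvector
      have hx' : adjoint T (T x) - x = -x := by simpa using hx.apply_eq_smul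
      refine absurd (hinj x ?_) hx.2
      have h0 : adjoint T (T x) = 0 := by simpa using hx'
      rw [← inner_self_eq_zero (𝕜 := ℂ), ← adjoint_inner_left, h0, inner_zero_left]
    · rw [spectrum.mem_resolventSet_iff] at h
      have h' := h.neg
      rwa [map_neg, map_one, neg_sub, sub_neg_eq_add, sub_add_cancel] at h'
  obtain ⟨S, hS⟩ := hunit.exists_right_inv
  have hTS : T * (S * adjoint T) = 1 := by
    ext y
    refine sub_eq_zero.1 (hinj_adj _ ?_)
    have h := congr($hS (adjoint T y))
    simp only [mul_apply_eq_comp] at h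
    simp [h]
  have key : T * adjoint T - 1 = T * (adjoint T * T - 1) * (S * adjoint T) := by
    rw [mul_sub, sub_mul, mul_one, hTS, ← mul_assoc T, mul_assoc (T * adjoint T), hTS, mul_one]
  rw [key]
  exact (hT.mul_left T).mul_right _

/-- `T* T` and `V* V` agree modulo compact operators as soon as `T` and `V` do. -/
lemma isCompactOperator_adjoint_mul_self_sub {T V : H →L[ℂ] H}
    (h : IsCompactOperator ⇑(T - V)) (h' : IsCompactOperator ⇑(adjoint T - adjoint V)) :
    IsCompactOperator ⇑(adjoint T * T - adjoint V * V) := by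
  have key : adjoint T * T - adjoint V * V
      = adjoint T * (T - V) + (adjoint T - adjoint V) * V := by noncomm_ring
  rw [key]
  exact (h.mul_left _).add (h'.mul_right _)

/-- An operator which is injective and commutes with a jointly injective sequence of finite-rank
orthogonal projections has injective adjoint. -/
lemma adjoint_injective_of_commute {Q : ℕ → H →L[ℂ] H} (hsa : ∀ k, IsSelfAdjoint (Q k))
    (hidem : ∀ k, Q k * Q k = Q k)
    (hfin : ∀ k, FiniteDimensional ℂ (LinearMap.range (Q k : H →ₗ[ℂ] H)))
    (hzero : ∀ x, (∀ k, Q k x = 0) → x = 0) {T : H →L[ℂ] H}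
    (hcomm : ∀ k, T * Q k = Q k * T) (hinj : ∀ x, T x = 0 → x = 0) (y : H)
    (hy : adjoint T y = 0) : y = 0 := by
  refine hzero y fun k => ?_
  let R := LinearMap.range (Q k : H →ₗ[ℂ] H)
  have hmap : ∀ x ∈ R, (T : H →ₗ[ℂ] H) x ∈ R := by
    rintro _ ⟨x, rfl⟩
    exact ⟨T x, congr($(hcomm k) x).symm⟩
  have hsurj : Function.Surjective ((T : H →ₗ[ℂ] H).restrict hmap) := by
    refine LinearMap.surjective_of_injective ((injective_iff_map_eq_zero _).2 fun x hx => ?_)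
    exact Subtype.ext (hinj x congr(($hx : H)))
  obtain ⟨z, hz⟩ := hsurj ⟨Q k y, y, rfl⟩
  have hz' : T z = Q k y := congr(($hz : H))
  rw [← inner_self_eq_zero (𝕜 := ℂ), ← adjoint_inner_right, (hsa k).adjoint_eq,
    ← mul_apply_eq_comp, hidem, ← hz', ← adjoint_inner_left, hy, inner_zero_left]

end Hilbert

/-- let `H = ⊕ H_k` with `H_k` the (finite-dimensional, nonzero) ranges of
pairwise orthogonal projections `Q k` summing strongly to `I`. If `V` is block diagonal
(commutes with all `Q k`) and `V* V − 1` is compact, then the image of `V` in the Calkin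
algebra is invertible, i.e. `V` is invertible modulo compacts; consequently such a `V`
also satisfies that `V V* − 1` is compact (every isometry in the algebra of images of
block-diagonal operators is a unitary). -/
theorem stmt_16 {H : Type*} [NormedAddCommGroup H] [InnerProductSpace ℂ H]
    [CompleteSpace H] (Q : ℕ → H →L[ℂ] H)
    (hsa : ∀ k, IsSelfAdjoint (Q k)) (hidem : ∀ k, Q k * Q k = Q k)
    (hfin : ∀ k, FiniteDimensional ℂ (LinearMap.range (Q k : H →ₗ[ℂ] H)))
    (hne : ∀ k, Q k ≠ 0)
    (horth : ∀ k j, k ≠ j → Q k * Q j = 0)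
    (hsum : ∀ x : H, HasSum (fun k => Q k x) x)
    (V : H →L[ℂ] H) (hcomm : ∀ k, V * Q k = Q k * V)
    (hiso : IsCompactOperator ⇑(ContinuousLinearMap.adjoint V * V - 1)) :
    (∃ W : H →L[ℂ] H,
        IsCompactOperator ⇑(V * W - 1) ∧ IsCompactOperator ⇑(W * V - 1)) ∧
      IsCompactOperator ⇑(V * ContinuousLinearMap.adjoint V - 1) := by
  have hzero : ∀ x : H, (∀ k, Q k x = 0) → x = 0 := fun x hx =>
    (hsum x).unique (by simp [hx])
  have hker : FiniteDimensional ℂ (Module.End.eigenspace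
      (ContinuousLinearMap.adjoint V * V - 1 : H →L[ℂ] H).toLinearMap (-1)) :=
    ContinuousLinearMap.finite_dimensional_eigenspace hiso (-1) (by norm_num)
  obtain ⟨N, hN⟩ := exists_forall_lt_imp_eq_zero (fun k => (Q k : H →ₗ[ℂ] H)) hzero
    (Module.End.eigenspace (ContinuousLinearMap.adjoint V * V - 1 : H →L[ℂ] H).toLinearMap (-1))
  -- Replace the first `N` blocks of `V` by the identity; this makes the operator injective.
  let F : H →L[ℂ] H := ∑ k ∈ Finset.range N, Q k
  let T : H →L[ℂ] H := V + (1 - V) * F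
  have hF : IsCompactOperator ⇑F :=
    (compactOperator (RingHom.id ℂ) H H).sum_mem fun k _ =>
      isCompactOperator_of_finiteDimensional_range (Q k)
  have hF_sa : ContinuousLinearMap.adjoint F = F := by
    simp [F, map_sum, fun k => (hsa k).adjoint_eq]
  have hTV : IsCompactOperator ⇑(T - V) := by
    rw [show T - V = (1 - V) * F by simp [T]]
    exact hF.mul_left _
  have hTV_adj :
      IsCompactOperator ⇑(ContinuousLinearMap.adjoint T - ContinuousLinearMap.adjoint V) := by
    have h : ContinuousLinearMap.adjoint T - ContinuousLinearMap.adjoint V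
        = F * ContinuousLinearMap.adjoint (1 - V) := by
      rw [← map_sub, show T - V = (1 - V) * F by simp [T]]
      exact (ContinuousLinearMap.adjoint_comp _ _).trans (by rw [hF_sa]; rfl)
    rw [h]
    exact hF.mul_right _
  have hFQ (k : ℕ) : F * Q k = Q k * F := by
    simp only [F, Finset.sum_mul, Finset.mul_sum]
    refine Finset.sum_congr rfl fun j _ => ?_
    rcases eq_or_ne j k with rfl | hjk
    · rfl
    · rw [horth j k hjk, horth k j hjk.symm]
  have hTQ (k : ℕ) : T * Q k = Q k * T := by
    simp only [T, add_mul, mul_add, mul_assoc, sub_mul, mul_sub, one_mul, hFQ, hcomm]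
    simp only [← mul_assoc, hcomm]
  have hQF (k : ℕ) (hk : k < N) : Q k * F = Q k := by
    simp only [F, Finset.mul_sum]
    rw [Finset.sum_eq_single_of_mem k (Finset.mem_range.2 hk) fun j _ hj => horth k j hj.symm,
      hidem]
  have hQT (k : ℕ) (hk : k < N) : Q k * T = Q k := by
    simp only [T, mul_add, mul_sub, sub_mul, one_mul, hQF k hk]
    rw [← mul_assoc, ← hcomm, mul_assoc, hQF k hk]
    abel
  have hinj (x : H) (hx : T x = 0) : x = 0 := by
    have hQx (k : ℕ) (hk : k < N) : Q k x = 0 := by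
      rw [← hQT k hk, mul_apply_eq_comp, hx, map_zero]
    have hFx : F x = 0 := by
      simp only [F, sum_apply]
      exact Finset.sum_eq_zero fun k hk => hQx k (Finset.mem_range.1 hk)
    have hVx : V x = 0 := by simpa [T, hFx] using hx
    exact hN x (by simp [hVx]) hQx
  have hTT : IsCompactOperator ⇑(ContinuousLinearMap.adjoint T * T - 1) := by
    rw [← sub_add_sub_cancel _ (ContinuousLinearMap.adjoint V * V)]
    exact (isCompactOperator_adjoint_mul_self_sub hTV hTV_adj).add hiso
  have hTT' := isCompactOperator_mul_adjoint_sub_one_of_injective hTT hinj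
    (adjoint_injective_of_commute hsa hidem hfin hzero hTQ hinj)
  have hVV : IsCompactOperator ⇑(V * ContinuousLinearMap.adjoint V - 1) := by
    have h := isCompactOperator_adjoint_mul_self_sub (T := ContinuousLinearMap.adjoint T)
      (V := ContinuousLinearMap.adjoint V) hTV_adj
      (by simpa only [ContinuousLinearMap.adjoint_adjoint] using hTV)
    simp only [ContinuousLinearMap.adjoint_adjoint] at h
    rw [← sub_sub_sub_cancel_left 1 (V * ContinuousLinearMap.adjoint V)
      (T * ContinuousLinearMap.adjoint T)]
    exact hTT'.sub h
  exact ⟨⟨ContinuousLinearMap.adjoint V, hVV, hiso⟩, hVV⟩
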